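/- Let p > 3 be a prime. Then the sum over k from 0 to p-1 of (2k+1) * T_k / (-4)^k is congruent to (-1)^((p-1)/2) * p + p^3 * E_{p-3} modulo p^4, where the congruence is understood in the rational numbers. -/

import Mathlib

/-- The Apéry-like numbers `T n = ∑ k ≤ n, (n.choose k)^2 * ((2k).choose n)^2`. -/
def apT (n : ℕ) : ℕ := ∑ k ∈ Finset.range (n + 1), (n.choose k) ^ 2 * ((2 * k).choose n) ^ 2
/-- The Euler numbers, defined by the e.g.f. `2 * exp t / (exp (2*t) + 1)`,
equivalently by `E 0 = 1` and the recurrence coming from `cosh t * sech t = 1`. -/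
def eulerNumber : ℕ → ℚ
  | 0 => 1
  | n + 1 => -∑ k ∈ (Finset.range (n + 1)).attach,
      if (n + 1 - k.1) % 2 = 0 then ((n + 1).choose k.1 : ℚ) * eulerNumber k.1 else 0
  decreasing_by exact Finset.mem_range.mp k.2

open Finset

/-! ### Binomial coefficients over `ℚ` -/

lemma cast_choose_succ_right (N m : ℕ) :
    (N.choose (m + 1) : ℚ) = N.choose m * (N - m) / (m + 1) := by
  rw [eq_div_iff (by positivity)]
  rcases le_total m N with h | h
  · have := Nat.choose_succ_right_eq N m
    rw [← Nat.cast_sub h]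
    exact_mod_cast this
  · rcases h.eq_or_lt with rfl | h
    · simp
    · simp [Nat.choose_eq_zero_of_lt h, Nat.choose_eq_zero_of_lt (h.trans (Nat.lt_succ_self m))]

lemma cast_choose_succ_left (N m : ℕ) :
    (N.choose m : ℚ) = (N + 1).choose m * (N + 1 - m) / (N + 1) := by
  rw [eq_div_iff (by positivity)]
  rcases le_or_gt m (N + 1) with h | h
  · have := Nat.choose_mul_succ_eq N m
    have e : ((N : ℚ) + 1 - m) = ((N + 1 - m : ℕ) : ℚ) := by rw [Nat.cast_sub h]; push_cast; ring
    rw [e]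
    exact_mod_cast this
  · simp [Nat.choose_eq_zero_of_lt h, Nat.choose_eq_zero_of_lt ((Nat.lt_succ_self N).trans h)]

lemma cast_choose_succ_succ (N m : ℕ) :
    ((N + 1).choose (m + 1) : ℚ) = N.choose m * (N + 1) / (m + 1) := by
  rw [eq_div_iff (by positivity)]
  have := Nat.add_one_mul_choose_eq N m
  have h : ((N + 1 : ℕ) : ℚ) * N.choose m = (N + 1).choose (m + 1) * (m + 1 : ℕ) := by
    exact_mod_cast this
  push_cast at h
  linarith

/-! ### The three-term recurrence of `apT` -/

lemma apT_eq_sum (n N : ℕ) (h : n < N) :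
    (apT n : ℚ) = ∑ k ∈ range N, (n.choose k : ℚ) ^ 2 * ((2 * k).choose n : ℚ) ^ 2 := by
  rw [apT]
  push_cast
  refine sum_subset (range_subset_range.2 h) fun k _ hk => ?_
  rw [Nat.choose_eq_zero_of_lt (by simpa using hk)]
  simp

lemma apT_recurrence (n : ℕ) :
    ((n : ℚ) + 2) ^ 3 * apT (n + 2)
      - 4 * (2 * n + 3) * (3 * (n + 1) ^ 2 + 3 * (n + 1) + 1) * apT (n + 1)
      + 16 * (n + 1) ^ 3 * apT n = 0 := by
  rw [apT_eq_sum (n + 2) (n + 3) (by omega), apT_eq_sum (n + 1) (n + 3) (by omega),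
    apT_eq_sum n (n + 3) (by omega), mul_sum, mul_sum, mul_sum, ← sum_sub_distrib,
    ← sum_add_distrib]
  let G : ℕ → ℚ := fun k => ((n + 2).choose k : ℚ) ^ 2 * ((2 * k).choose (n + 2) : ℚ) ^ 2 *
    (((n : ℚ) + 2) ^ 2 * (7 * n + 10) - 8 * (2 * n + 3) * (n + 2) * k + 4 * (2 * n + 3) * k ^ 2)
  refine (sum_congr rfl fun k _ => show _ = G (k + 1) - G k from ?_).trans
    ((sum_range_sub G _).trans ?_)
  · have e1 := cast_choose_succ_left (n + 1) k
    have e2 := cast_choose_succ_left n k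
    have e3 := cast_choose_succ_right (2 * k) n
    have e4 := cast_choose_succ_right (2 * k) (n + 1)
    have e5 := cast_choose_succ_right (n + 2) k
    have e6 := cast_choose_succ_succ (2 * k + 1) (n + 1)
    have e7 := cast_choose_succ_succ (2 * k) n
    simp only [G]
    rw [show 2 * (k + 1) = 2 * k + 1 + 1 by ring, e5, e6, e7, e4, e3, e2, e1]
    push_cast
    generalize ((n + 1 + 1).choose k : ℚ) = x
    generalize ((2 * k).choose n : ℚ) = y
    field_simp
    ring
  · simp [G]

/-! ### A hypergeometric representation of `apT` -/

/-- The multinomial coefficient `(4k)! / k!^4` scaled by `16^k`. -/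
def quadMultinomial (k : ℕ) : ℚ := (4 * k).factorial / ((k.factorial : ℚ) ^ 4 * 16 ^ k)

lemma quadMultinomial_succ (k : ℕ) :
    quadMultinomial (k + 1) = quadMultinomial k *
      ((4 * k + 4) * (4 * k + 3) * (4 * k + 2) * (4 * k + 1)) / (16 * (k + 1) ^ 4) := by
  have := Nat.factorial_ne_zero k
  simp only [quadMultinomial, show 4 * (k + 1) = 4 * k + 1 + 1 + 1 + 1 by ring,
    Nat.factorial_succ]
  push_cast
  field_simp
  ring

lemma choose_add_four (a m : ℕ) :
    ((a + 2).choose (m + 4) : ℚ) = a.choose m *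
      ((a + 2) * (a + 1) * (a - m) * (a - m - 1)) /
        ((m + 4) * (m + 3) * (m + 2) * (m + 1)) := by
  rw [cast_choose_succ_succ (a + 1) (m + 3), cast_choose_succ_succ a (m + 2),
    cast_choose_succ_right a (m + 1), cast_choose_succ_right a m]
  push_cast
  field_simp
  ring

lemma sum_quadMultinomial_recurrence (n N : ℕ) (h : n + 2 < 2 * N) :
    ((n : ℚ) + 2) ^ 3 * ∑ k ∈ range N, quadMultinomial k * (n + 2 + 2 * k).choose (4 * k)
      - (2 * n + 3) * (3 * (n + 1) ^ 2 + 3 * (n + 1) + 1) *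
        ∑ k ∈ range N, quadMultinomial k * (n + 1 + 2 * k).choose (4 * k)
      + (n + 1) ^ 3 * ∑ k ∈ range N, quadMultinomial k * (n + 2 * k).choose (4 * k) = 0 := by
  rw [mul_sum, mul_sum, mul_sum, ← sum_sub_distrib, ← sum_add_distrib]
  let G : ℕ → ℚ := fun k => quadMultinomial k * (n + 2 + 2 * k).choose (4 * k) *
    (-32 * (2 * n + 3) * k ^ 4 / ((n + 2 + 2 * k) * (n + 1 + 2 * k)))
  refine (sum_congr rfl fun k _ => show _ = G (k + 1) - G k from ?_).trans
    ((sum_range_sub G _).trans ?_)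
  · have e1 := cast_choose_succ_left (n + 1 + 2 * k) (4 * k)
    have e2 := cast_choose_succ_left (n + 2 * k) (4 * k)
    have e3 := choose_add_four (n + 2 + 2 * k) (4 * k)
    rw [show n + 1 + 2 * k + 1 = n + 2 + 2 * k by ring] at e1
    rw [show n + 2 * k + 1 = n + 1 + 2 * k by ring] at e2
    simp only [G]
    rw [show n + 2 + 2 * (k + 1) = n + 2 + 2 * k + 2 by ring, show 4 * (k + 1) = 4 * k + 4 by ring,
      e3, e2, e1, quadMultinomial_succ]
    push_cast
    generalize ((n + 2 + 2 * k).choose (4 * k) : ℚ) = x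
    field_simp
    ring
  · simp only [G]
    rw [Nat.choose_eq_zero_of_lt (by omega)]
    simp

lemma apT_eq_sum_quadMultinomial (N n : ℕ) (h : n < N) :
    (apT n : ℚ) = 4 ^ n * ∑ k ∈ range N, quadMultinomial k * (n + 2 * k).choose (4 * k) := by
  induction n using Nat.strong_induction_on with
  | _ n ih =>
    match n with
    | 0 =>
      rw [sum_eq_single_of_mem 0 (mem_range.2 h)]
      · simp [apT, quadMultinomial]
      · intro k _ hk
        rw [Nat.choose_eq_zero_of_lt (by omega)]
        simp
    | 1 =>
      rw [sum_eq_single_of_mem 0 (mem_range.2 (by omega))]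
      · simp [apT, quadMultinomial, sum_range_succ]
      · intro k _ hk
        rw [Nat.choose_eq_zero_of_lt (by omega)]
        simp
    | n + 2 =>
      have h1 := apT_recurrence n
      have h2 := sum_quadMultinomial_recurrence n N (by omega)
      rw [ih n (by omega) (by omega), ih (n + 1) (by omega) (by omega)] at h1
      have h3 : ((n : ℚ) + 2) ^ 3 ≠ 0 := by positivity
      apply mul_left_cancel₀ h3
      linear_combination h1 - 16 * 4 ^ n * h2

lemma sum_neg_one_pow_mul_choose (m N : ℕ) :
    ∑ n ∈ range N, (-1 : ℚ) ^ n * (2 * n + 1) * (n + m).choose (2 * m)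
      = -(-1) ^ N * ((N - m) * (N + m).choose (2 * m)) := by
  induction N with
  | zero => rcases m.eq_zero_or_pos with rfl | hm
            · simp
            · simp [Nat.choose_eq_zero_of_lt (show m < 2 * m by omega)]
  | succ N ih =>
    rw [sum_range_succ, ih, cast_choose_succ_left (N + m) (2 * m),
      show N + 1 + m = N + m + 1 by ring]
    push_cast
    field_simp
    ring

/-- The product `∏_{j ≤ k} (1 - x² / (4 j²))`. -/
def sineProduct (x : ℚ) (k : ℕ) : ℚ := ∏ j ∈ range k, (1 - x ^ 2 / (4 * ((j : ℚ) + 1) ^ 2))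

lemma quadMultinomial_mul_choose (m k : ℕ) :
    quadMultinomial k * (((2 * m + 1 : ℕ) : ℚ) - (2 * k : ℕ)) * (2 * m + 1 + 2 * k).choose (4 * k)
      = (2 * m + 1 : ℕ) * ((-1) ^ k * m.choose k * (m + k).choose k *
        sineProduct (2 * m + 1 : ℕ) k) := by
  induction k with
  | zero => simp [quadMultinomial, sineProduct]
  | succ k ih =>
    have e1 := choose_add_four (2 * m + 1 + 2 * k) (4 * k)
    rw [show 2 * m + 1 + 2 * (k + 1) = 2 * m + 1 + 2 * k + 2 by ring,
      show 4 * (k + 1) = 4 * k + 4 by ring, e1, quadMultinomial_succ, cast_choose_succ_right m k,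
      show m + (k + 1) = m + k + 1 by ring, cast_choose_succ_succ (m + k) k, sineProduct,
      prod_range_succ, ← sineProduct]
    push_cast at ih ⊢
    have h4 : (4 : ℚ) * k + 4 ≠ 0 := by positivity
    have h3 : (4 : ℚ) * k + 3 ≠ 0 := by positivity
    have h2 : (4 : ℚ) * k + 2 ≠ 0 := by positivity
    have h1 : (4 : ℚ) * k + 1 ≠ 0 := by positivity
    have h0 : (k : ℚ) + 1 ≠ 0 := by positivity
    field_simp
    linear_combination (4 * (2 * (m : ℚ) + 1 + 2 * k + 2) * (2 * m + 1 + 2 * k + 1) *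
      (2 * m - 2 * k) * (2 * m + 1 - 2 * (k + 1))) * ih

lemma sum_apT_eq (m : ℕ) :
    ∑ k ∈ range (2 * m + 1), (2 * (k : ℚ) + 1) * (apT k : ℚ) / (-4) ^ k
      = (2 * m + 1 : ℕ) * ∑ k ∈ range (2 * m + 1), (-1) ^ k * m.choose k * (m + k).choose k *
        sineProduct (2 * m + 1 : ℕ) k := by
  have h : ∀ n ∈ range (2 * m + 1), (2 * (n : ℚ) + 1) * (apT n : ℚ) / (-4) ^ n =
      ∑ k ∈ range (2 * m + 1), quadMultinomial k *
        ((-1) ^ n * (2 * n + 1) * (n + 2 * k).choose (2 * (2 * k))) := fun n hn => by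
    rw [apT_eq_sum_quadMultinomial _ n (mem_range.1 hn), neg_pow, mul_sum, mul_sum, sum_div]
    refine sum_congr rfl fun k _ => ?_
    rw [show 2 * (2 * k) = 4 * k by ring]
    have : ((-1 : ℚ) ^ n) * (-1) ^ n = 1 := by rw [← mul_pow]; simp
    field_simp
    linear_combination (-(quadMultinomial k * ((n + 2 * k).choose (4 * k) : ℚ))) * this
  rw [sum_congr rfl h, sum_comm, mul_sum]
  refine sum_congr rfl fun k _ => ?_
  rw [← mul_sum, sum_neg_one_pow_mul_choose, ← quadMultinomial_mul_choose,
    show 2 * (2 * k) = 4 * k by ring]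
  rw [pow_succ, pow_mul]
  simp
  ring

/-! ### Alternating Legendre-type sums -/

/-- The generalized harmonic number of order two. -/
def harmonicTwo (k : ℕ) : ℚ := ∑ j ∈ range k, 1 / ((j : ℚ) + 1) ^ 2

lemma choose_mul_choose_telescope (n k : ℕ) :
    (-1 : ℚ) ^ k * (n + 1).choose k * (n + k).choose k =
      (-1) ^ k * k ^ 2 * (n + 1).choose k * (n + k).choose k / (n + 1) ^ 2 -
        (-1) ^ (k + 1) * ((k + 1 : ℕ) : ℚ) ^ 2 * (n + 1).choose (k + 1) *
          (n + (k + 1)).choose (k + 1) / (n + 1) ^ 2 := by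
  rw [cast_choose_succ_right (n + 1) k, show n + (k + 1) = n + k + 1 by ring,
    cast_choose_succ_succ (n + k) k]
  push_cast
  field_simp
  ring

lemma sum_choose_mul_choose (n N : ℕ) (h : n + 1 < N) :
    ∑ k ∈ range N, (-1 : ℚ) ^ k * (n + 1).choose k * (n + k).choose k = 0 := by
  rw [sum_congr rfl fun k _ => choose_mul_choose_telescope n k]
  rw [sum_range_sub' fun k : ℕ =>
    (-1 : ℚ) ^ k * k ^ 2 * (n + 1).choose k * (n + k).choose k / (n + 1) ^ 2]
  simp [Nat.choose_eq_zero_of_lt h]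

lemma choose_mul_choose_add_succ (n k : ℕ) :
    ((n + 1).choose k : ℚ) * (n + 1 + k).choose k + n.choose k * (n + k).choose k =
      2 * ((n + 1).choose k * (n + k).choose k) := by
  have e := cast_choose_succ_left (n + k) k
  rw [show n + k + 1 = n + 1 + k by ring] at e
  rw [cast_choose_succ_left n k, e]
  push_cast
  field_simp
  ring

lemma sum_legendre (N n : ℕ) (h : n < N) :
    ∑ k ∈ range N, (-1 : ℚ) ^ k * n.choose k * (n + k).choose k = (-1) ^ n := by
  induction n with
  | zero =>
    rw [sum_eq_single_of_mem 0 (mem_range.2 h)]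
    · simp
    · intro k _ hk
      rw [Nat.choose_eq_zero_of_lt (by omega)]
      simp
  | succ n ih =>
    have h1 := sum_choose_mul_choose n N h
    have h2 : ∑ k ∈ range N, (-1 : ℚ) ^ k * (n + 1).choose k * (n + 1 + k).choose k +
        ∑ k ∈ range N, (-1 : ℚ) ^ k * n.choose k * (n + k).choose k =
        2 * ∑ k ∈ range N, (-1 : ℚ) ^ k * (n + 1).choose k * (n + k).choose k := by
      rw [← sum_add_distrib, mul_sum]
      refine sum_congr rfl fun k _ => ?_
      linear_combination (-1 : ℚ) ^ k * choose_mul_choose_add_succ n k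
    rw [ih (by omega), h1] at h2
    linear_combination h2

lemma sum_choose_mul_choose_mul_harmonicTwo (n N : ℕ) (h : n + 1 < N) :
    ∑ k ∈ range N, (-1 : ℚ) ^ k * (n + 1).choose k * (n + k).choose k * harmonicTwo k
      = -1 / (n + 1) ^ 2 := by
  let u : ℕ → ℚ := fun k =>
    (-1 : ℚ) ^ k * k ^ 2 * (n + 1).choose k * (n + k).choose k / (n + 1) ^ 2
  let a : ℕ → ℚ := fun k => (-1 : ℚ) ^ k * (n + 1).choose k * (n + k).choose k
  have h1 : ∀ k ∈ range N, (-1 : ℚ) ^ k * (n + 1).choose k * (n + k).choose k * harmonicTwo k =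
      (u k * harmonicTwo k - u (k + 1) * harmonicTwo (k + 1)) + a (k + 1) / (n + 1) ^ 2 :=
    fun k _ => by
    have e : harmonicTwo (k + 1) = harmonicTwo k + 1 / ((k : ℚ) + 1) ^ 2 := by
      simp [harmonicTwo, sum_range_succ]
    have e2 : u (k + 1) * (1 / ((k : ℚ) + 1) ^ 2) = a (k + 1) / (n + 1) ^ 2 := by
      simp only [u, a]
      push_cast
      field_simp
    rw [choose_mul_choose_telescope, e, ← e2]
    simp only [u]
    ring
  have h2 : ∑ k ∈ range N, a (k + 1) = -1 := by
    have := sum_choose_mul_choose n (N + 1) (by omega)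
    rw [sum_range_succ'] at this
    simp only [a]
    simp at this ⊢
    linear_combination this
  rw [sum_congr rfl h1, sum_add_distrib, sum_range_sub' fun k => u k * harmonicTwo k, ← sum_div, h2]
  simp [u, Nat.choose_eq_zero_of_lt h]

lemma sum_legendre_mul_harmonicTwo (N n : ℕ) (h : n < N) :
    ∑ k ∈ range N, (-1 : ℚ) ^ k * n.choose k * (n + k).choose k * harmonicTwo k =
      -2 * (-1) ^ n * ∑ j ∈ range n, (-1) ^ (j + 1) / ((j : ℚ) + 1) ^ 2 := by
  induction n with
  | zero =>
    rw [sum_eq_single_of_mem 0 (mem_range.2 h)]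
    · simp [harmonicTwo]
    · intro k _ hk
      rw [Nat.choose_eq_zero_of_lt (by omega)]
      simp
  | succ n ih =>
    have h1 := sum_choose_mul_choose_mul_harmonicTwo n N h
    have h2 : ∑ k ∈ range N, (-1 : ℚ) ^ k * (n + 1).choose k * (n + 1 + k).choose k *
          harmonicTwo k +
        ∑ k ∈ range N, (-1 : ℚ) ^ k * n.choose k * (n + k).choose k * harmonicTwo k =
        2 * ∑ k ∈ range N, (-1 : ℚ) ^ k * (n + 1).choose k * (n + k).choose k *
          harmonicTwo k := by
      rw [← sum_add_distrib, mul_sum]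
      refine sum_congr rfl fun k _ => ?_
      linear_combination (-1 : ℚ) ^ k * harmonicTwo k * choose_mul_choose_add_succ n k
    rw [ih (by omega), h1] at h2
    rw [sum_range_succ]
    have h3 : ((-1 : ℚ) ^ n) * (-1) ^ n = 1 := by rw [← mul_pow]; simp
    have h4 : -2 * (-1 : ℚ) ^ (n + 1) * ((-1) ^ (n + 1) / ((n : ℚ) + 1) ^ 2) =
        2 * (-1 / (n + 1) ^ 2) := by
      rw [pow_succ]
      linear_combination (-2 / ((n : ℚ) + 1) ^ 2) * h3
    rw [mul_add, h4]
    linear_combination h2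

/-! ### Euler numbers -/

lemma eulerNumber_succ (n : ℕ) : eulerNumber (n + 1) = -∑ k ∈ range (n + 1),
    if (n + 1 - k) % 2 = 0 then ((n + 1).choose k : ℚ) * eulerNumber k else 0 := by
  rw [eulerNumber, sum_attach (range (n + 1)) fun k =>
    if (n + 1 - k) % 2 = 0 then ((n + 1).choose k : ℚ) * eulerNumber k else 0]

lemma sum_choose_mul_eulerNumber (n : ℕ) :
    ∑ k ∈ range (n + 1), (if (n - k) % 2 = 0 then (n.choose k : ℚ) * eulerNumber k else 0)
      = if n = 0 then 1 else 0 := by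
  rcases n with _ | n
  · simp [eulerNumber]
  · rw [sum_range_succ, eulerNumber_succ]
    simp

lemma eulerNumber_of_odd (n : ℕ) (hn : n % 2 = 1) : eulerNumber n = 0 := by
  induction n using Nat.strong_induction_on with
  | _ n ih =>
    obtain ⟨n, rfl⟩ : ∃ k, n = k + 1 := ⟨n - 1, by omega⟩
    rw [eulerNumber_succ, sum_eq_zero, neg_zero]
    intro k hk
    have hk := mem_range.1 hk
    split_ifs with h
    · rw [ih k hk (by omega), mul_zero]
    · rfl

lemma exists_int_eulerNumber (n : ℕ) : ∃ z : ℤ, eulerNumber n = z := by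
  induction n using Nat.strong_induction_on with
  | _ n ih =>
    rcases n with _ | n
    · exact ⟨1, by simp [eulerNumber]⟩
    · choose! f hf using ih
      refine ⟨-∑ k ∈ range (n + 1), if (n + 1 - k) % 2 = 0 then ((n + 1).choose k : ℤ) * f k else 0,
        ?_⟩
      rw [eulerNumber_succ]
      push_cast
      congr 1
      refine sum_congr rfl fun k hk => ?_
      rw [hf k (mem_range.1 hk)]

/-- The polynomial `2^m * E_m((x + 1) / 2)`, with `E_m` the Euler polynomial. -/
def eulerPoly (m : ℕ) (x : ℚ) : ℚ :=
  ∑ j ∈ range (m + 1), (m.choose j : ℚ) * eulerNumber j * x ^ (m - j)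

lemma add_one_pow_add_sub_one_pow (x : ℚ) (a : ℕ) :
    (x + 1) ^ a + (x - 1) ^ a =
      ∑ i ∈ range (a + 1), a.choose i * x ^ i * if (a - i) % 2 = 0 then 2 else 0 := by
  rw [sub_eq_add_neg, add_pow, add_pow, ← sum_add_distrib]
  refine sum_congr rfl fun i _ => ?_
  split_ifs with h
  · rw [Even.neg_one_pow (Nat.even_iff.2 h)]
    ring
  · rw [Odd.neg_one_pow (Nat.odd_iff.2 (by omega))]
    ring

lemma eulerPoly_add_one_add_sub_one (m : ℕ) (x : ℚ) :
    eulerPoly m (x + 1) + eulerPoly m (x - 1) = 2 * x ^ m := by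
  have h : eulerPoly m (x + 1) + eulerPoly m (x - 1) =
      ∑ j ∈ range (m + 1), ∑ i ∈ range (m - j + 1), 2 * ((m.choose i : ℚ) * x ^ i *
        if (m - i - j) % 2 = 0 then ((m - i).choose j : ℚ) * eulerNumber j else 0) := by
    rw [eulerPoly, eulerPoly, ← sum_add_distrib]
    refine sum_congr rfl fun j hj => ?_
    rw [← mul_add, add_one_pow_add_sub_one_pow, mul_sum]
    refine sum_congr rfl fun i hi => ?_
    have hj := mem_range.1 hj
    have hi := mem_range.1 hi
    have e1 := Nat.choose_mul (n := m) (k := i + j) (s := j) (by omega)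
    have e2 := Nat.choose_mul (n := m) (k := i + j) (s := i) (by omega)
    rw [Nat.add_sub_cancel] at e1
    rw [Nat.add_sub_cancel_left, Nat.choose_symm_add, e1] at e2
    have e3 : (m.choose j : ℚ) * (m - j).choose i = m.choose i * (m - i).choose j := by
      exact_mod_cast e2
    rw [show m - j - i = m - i - j by omega]
    split_ifs
    · linear_combination (2 * eulerNumber j * x ^ i) * e3
    · ring
  rw [h, sum_comm' (t' := range (m + 1)) (s' := fun i => range (m - i + 1))
    (by intro a b; simp only [mem_range]; omega)]
  simp_rw [← mul_sum, sum_choose_mul_eulerNumber]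
  rw [sum_eq_single_of_mem m (by simp)]
  · simp
  · intro i hi hne
    have := mem_range.1 hi
    rw [if_neg (by omega)]
    simp

lemma eulerPoly_one (m : ℕ) (hm : m % 2 = 0) (h0 : m ≠ 0) : eulerPoly m 1 = 0 := by
  have h1 := eulerPoly_add_one_add_sub_one m 0
  have h2 : eulerPoly m (-1) = eulerPoly m 1 := by
    refine sum_congr rfl fun j hj => ?_
    have := mem_range.1 hj
    rcases Nat.mod_two_eq_zero_or_one j with h | h
    · rw [Even.neg_one_pow (Nat.even_iff.2 (by omega)), one_pow]
    · rw [eulerNumber_of_odd j h]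
      simp
  rw [zero_add, zero_sub, h2, zero_pow h0] at h1
  linarith

lemma sum_neg_one_pow_mul_pow (m n : ℕ) (hm : m % 2 = 0) (h0 : m ≠ 0) :
    2 ^ (m + 1) * ∑ j ∈ range n, (-1 : ℚ) ^ (j + 1) * ((j : ℚ) + 1) ^ m =
      (-1) ^ n * eulerPoly m (2 * n + 1) := by
  induction n with
  | zero => simp [eulerPoly_one m hm h0]
  | succ n ih =>
    have h := eulerPoly_add_one_add_sub_one m (2 * (n + 1))
    rw [sum_range_succ, mul_add, ih]
    rw [show (2 * ((n : ℚ) + 1) - 1) = 2 * n + 1 by ring, mul_pow] at h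
    push_cast
    linear_combination ((-1) ^ (n + 1)) * (-h)

/-! ### Congruences between rational numbers -/

/-- `RatDvd p r x` says that `x` is congruent to zero modulo `p ^ r` as a rational number. -/
def RatDvd (p r : ℕ) (x : ℚ) : Prop := ∃ a b : ℤ, ¬ (p : ℤ) ∣ b ∧ x * b = (p : ℚ) ^ r * a

namespace RatDvd

variable {p r s : ℕ} {x y : ℚ}

lemma zero (hp : p.Prime) : RatDvd p r 0 :=
  ⟨0, 1, by exact_mod_cast hp.not_dvd_one, by simp⟩

lemma intCast (hp : p.Prime) (z : ℤ) : RatDvd p 0 z :=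
  ⟨z, 1, by exact_mod_cast hp.not_dvd_one, by simp⟩

lemma of_dvd (hp : p.Prime) {z : ℤ} (h : (p : ℤ) ∣ z) : RatDvd p 1 z := by
  obtain ⟨w, rfl⟩ := h
  exact ⟨w, 1, by exact_mod_cast hp.not_dvd_one, by push_cast; ring⟩

lemma self_pow (hp : p.Prime) : RatDvd p r ((p : ℚ) ^ r) :=
  ⟨1, 1, by exact_mod_cast hp.not_dvd_one, by simp⟩

lemma one_div {z : ℤ} (h : ¬ (p : ℤ) ∣ z) : RatDvd p 0 (1 / z) := by
  refine ⟨1, z, h, ?_⟩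
  have : (z : ℚ) ≠ 0 := by
    rintro h0
    exact h (by simp [Int.cast_eq_zero.1 h0])
  field_simp
  simp

lemma add (hp : p.Prime) (hx : RatDvd p r x) (hy : RatDvd p r y) : RatDvd p r (x + y) := by
  obtain ⟨a, b, hb, h⟩ := hx
  obtain ⟨c, d, hd, h'⟩ := hy
  refine ⟨a * d + c * b, b * d, fun h => ?_, ?_⟩
  · exact ((Nat.prime_iff_prime_int.1 hp).dvd_or_dvd h).elim hb hd
  · push_cast
    linear_combination (d : ℚ) * h + b * h'

lemma mul (hp : p.Prime) (hx : RatDvd p r x) (hy : RatDvd p s y) :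
    RatDvd p (r + s) (x * y) := by
  obtain ⟨a, b, hb, h⟩ := hx
  obtain ⟨c, d, hd, h'⟩ := hy
  refine ⟨a * c, b * d, fun h => ?_, ?_⟩
  · exact ((Nat.prime_iff_prime_int.1 hp).dvd_or_dvd h).elim hb hd
  · push_cast
    rw [pow_add]
    linear_combination (y * d : ℚ) * h + (p : ℚ) ^ r * a * h'

lemma mul_left (hp : p.Prime) (hx : RatDvd p 0 x) (hy : RatDvd p r y) : RatDvd p r (x * y) := by
  simpa using hx.mul hp hy

lemma neg (hx : RatDvd p r x) : RatDvd p r (-x) := by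
  obtain ⟨a, b, hb, h⟩ := hx
  exact ⟨-a, b, hb, by push_cast; linear_combination -h⟩

lemma sub (hp : p.Prime) (hx : RatDvd p r x) (hy : RatDvd p r y) : RatDvd p r (x - y) := by
  rw [sub_eq_add_neg]
  exact hx.add hp hy.neg

lemma mono (h : s ≤ r) (hx : RatDvd p r x) : RatDvd p s x := by
  obtain ⟨a, b, hb, e⟩ := hx
  refine ⟨p ^ (r - s) * a, b, hb, ?_⟩
  push_cast
  rw [e, ← mul_assoc, ← pow_add, Nat.add_sub_cancel' h]

lemma sum (hp : p.Prime) {ι : Type*} {t : Finset ι} {f : ι → ℚ} (h : ∀ i ∈ t, RatDvd p r (f i)) :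
    RatDvd p r (∑ i ∈ t, f i) :=
  Finset.sum_induction f (RatDvd p r) (fun _ _ ha hb => ha.add hp hb) (zero hp) h

lemma dvd_num (hp : p.Prime) (hx : RatDvd p r x) : (p : ℤ) ^ r ∣ x.num := by
  obtain ⟨a, b, hb, h⟩ := hx
  have hpi := Nat.prime_iff_prime_int.1 hp
  have h1 : x.num * b = (p : ℤ) ^ r * (a * x.den) := by
    have h2 := Rat.mul_den_eq_num x
    have h3 : (x.num : ℚ) * b = (p : ℚ) ^ r * (a * x.den) := by
      rw [← h2]
      linear_combination (x.den : ℚ) * h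
    exact_mod_cast h3
  have hc : IsCoprime ((p : ℤ) ^ r) b := ((hpi.coprime_iff_not_dvd).2 hb).pow_left
  exact hc.dvd_of_dvd_mul_right ⟨_, h1⟩

end RatDvd

/-! ### Reduction modulo powers of `p` -/

lemma not_dvd_succ_of_lt {p j : ℕ} (h : j + 1 < p) : ¬ (p : ℤ) ∣ ((j + 1 : ℕ) : ℤ) := by
  rw [Int.natCast_dvd_natCast]
  exact Nat.not_dvd_of_pos_of_lt (by omega) h

lemma ratDvd_one_div_succ_sq {p j : ℕ} (hp : p.Prime) (h : j + 1 < p) :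
    RatDvd p 0 (1 / ((j : ℚ) + 1) ^ 2) := by
  have h1 := RatDvd.one_div (not_dvd_succ_of_lt h)
  have h2 := h1.mul hp h1
  convert h2 using 1
  push_cast
  rw [div_mul_div_comm, one_mul, sq]

lemma ratDvd_two_inv {p : ℕ} (hp3 : 3 < p) : RatDvd p 0 (1 / 2) := by
  simpa [one_add_one_eq_two] using
    RatDvd.one_div (not_dvd_succ_of_lt (show 1 + 1 < p by omega))

lemma ratDvd_harmonicTwo {p k : ℕ} (hp : p.Prime) (hk : k < p) : RatDvd p 0 (harmonicTwo k) :=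
  RatDvd.sum hp fun j hj => ratDvd_one_div_succ_sq hp (by have := mem_range.1 hj; omega)

lemma ratDvd_sineProduct_sub {p : ℕ} (hp : p.Prime) (hp3 : 3 < p) (k : ℕ) (hk : k < p) :
    RatDvd p 4 (sineProduct p k - (1 - (p : ℚ) ^ 2 / 4 * harmonicTwo k)) := by
  induction k with
  | zero => simpa [sineProduct, harmonicTwo] using RatDvd.zero hp
  | succ k ih =>
    have hq := ratDvd_two_inv hp3
    have h4 : RatDvd p 0 (1 / 4) := by
      convert hq.mul hp hq using 1
      norm_num
    have hj := ratDvd_one_div_succ_sq hp hk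
    have hpp := RatDvd.self_pow (r := 2) hp
    have hx : RatDvd p 2 (1 / 4 * (1 / ((k : ℚ) + 1) ^ 2 * (p : ℚ) ^ 2)) :=
      h4.mul_left hp (hj.mul_left hp hpp)
    have hy : RatDvd p 2 (1 / 4 * (harmonicTwo k * (p : ℚ) ^ 2)) :=
      h4.mul_left hp ((ratDvd_harmonicTwo hp (by omega)).mul_left hp hpp)
    have hx0 : RatDvd p 0 (1 - 1 / 4 * (1 / ((k : ℚ) + 1) ^ 2 * (p : ℚ) ^ 2)) := by
      refine RatDvd.sub hp ?_ (hx.mono (by omega))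
      exact_mod_cast RatDvd.intCast hp 1
    have key := (hx0.mul_left hp (ih (by omega))).add hp (hx.mul hp hy)
    convert key using 1
    rw [sineProduct, prod_range_succ, ← sineProduct, harmonicTwo, sum_range_succ, ← harmonicTwo]
    field_simp
    ring

lemma ratDvd_pow_sub_one {p j : ℕ} (hp : p.Prime) (h : j + 1 < p) :
    RatDvd p 1 (((j : ℚ) + 1) ^ (p - 1) - 1) := by
  have h1 : ((j + 1 : ℕ) : ℤ) ^ (p - 1) ≡ 1 [ZMOD p] := by
    refine Int.ModEq.pow_card_sub_one_eq_one hp ?_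
    exact (((Nat.prime_iff_prime_int.1 hp).coprime_iff_not_dvd).2 (not_dvd_succ_of_lt h)).symm
  have h2 := RatDvd.of_dvd hp h1.symm.dvd
  push_cast at h2
  exact h2

lemma ratDvd_eulerPoly_sub {p m : ℕ} (hp : p.Prime) :
    RatDvd p 1 (eulerPoly m p - eulerNumber m) := by
  rw [eulerPoly, sum_range_succ]
  simp only [Nat.choose_self, Nat.cast_one, one_mul, Nat.sub_self, pow_zero, mul_one,
    add_sub_cancel_right]
  refine RatDvd.sum hp fun j hj => ?_
  have := mem_range.1 hj
  obtain ⟨z, hz⟩ := exists_int_eulerNumber j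
  rw [hz]
  refine RatDvd.mul_left hp ?_ ((RatDvd.self_pow (r := m - j) hp).mono (by omega))
  exact_mod_cast RatDvd.intCast hp (m.choose j * z)

lemma ratDvd_sum_sub_eulerNumber {p m : ℕ} (hp : p.Prime) (hp3 : 3 < p) (hm : p = 2 * m + 1) :
    RatDvd p 1 (1 / 2 * (-1) ^ m * ∑ j ∈ range m, (-1) ^ (j + 1) / ((j : ℚ) + 1) ^ 2
      - eulerNumber (p - 3)) := by
  obtain ⟨q, rfl⟩ : ∃ q, p = q + 3 := ⟨p - 3, by omega⟩
  rw [Nat.add_sub_cancel]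
  have hsgn : ∀ i, RatDvd (q + 3) 0 ((-1) ^ i) := fun i => by
    exact_mod_cast RatDvd.intCast hp ((-1) ^ i)
  have hE := ratDvd_eulerPoly_sub (m := q) hp
  have hS := sum_neg_one_pow_mul_pow q m (by omega) (by omega)
  rw [show (2 * (m : ℚ) + 1) = ((q + 3 : ℕ) : ℚ) by rw [hm]; push_cast; ring] at hS
  have hpow : ∀ j ∈ range m, RatDvd (q + 3) 1
      ((-1) ^ (j + 1) * (1 / ((j : ℚ) + 1) ^ 2 * (((j : ℚ) + 1) ^ (q + 3 - 1) - 1))) :=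
    fun j hj => by
    have := mem_range.1 hj
    exact (hsgn _).mul_left hp
      ((ratDvd_one_div_succ_sq hp (by omega)).mul_left hp (ratDvd_pow_sub_one hp (by omega)))
  have h1 := RatDvd.sum hp hpow
  have h2 : ∑ j ∈ range m, (-1 : ℚ) ^ (j + 1) *
        (1 / ((j : ℚ) + 1) ^ 2 * (((j : ℚ) + 1) ^ (q + 3 - 1) - 1)) =
      ∑ j ∈ range m, (-1 : ℚ) ^ (j + 1) * ((j : ℚ) + 1) ^ q -
        ∑ j ∈ range m, (-1) ^ (j + 1) / ((j : ℚ) + 1) ^ 2 := by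
    rw [← sum_sub_distrib]
    refine sum_congr rfl fun j _ => ?_
    rw [show q + 3 - 1 = q + 2 by omega]
    field_simp
    ring
  rw [h2] at h1
  have h3 : RatDvd (q + 3) 1 ((2 : ℚ) ^ (q + 2) - 1) := by
    have := ratDvd_pow_sub_one (j := 1) hp (by omega)
    rw [show q + 3 - 1 = q + 2 by omega] at this
    norm_num at this
    exact this
  have h4 : RatDvd (q + 3) 0 (∑ j ∈ range m, (-1 : ℚ) ^ (j + 1) * ((j : ℚ) + 1) ^ q) := by
    exact_mod_cast RatDvd.intCast hp (∑ j ∈ range m, (-1 : ℤ) ^ (j + 1) * ((j : ℤ) + 1) ^ q)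
  have hhalf := (ratDvd_two_inv hp3).mul_left hp (hsgn m)
  have key := (hE.sub hp (hhalf.mul_left hp h1)).sub hp ((hhalf.mul_left hp h4).mul_left hp h3)
  convert key using 1
  have h5 : ((-1 : ℚ) ^ m) * (-1) ^ m = 1 := by rw [← mul_pow]; simp
  linear_combination ((-1 : ℚ) ^ m) * hS + eulerPoly q ((q + 3 : ℕ) : ℚ) * h5

/-- Theorem 1.2, equation (1.7): for a prime `p > 3`,
`∑_{k=0}^{p-1} (2k+1) T_k / (-4)^k ≡ (-1)^((p-1)/2) p + p^3 E_{p-3} (mod p^4)`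
as rational numbers. -/
theorem sun_conjecture_Tneg4 (p : ℕ) (hp : p.Prime) (hp3 : 3 < p) :
    ((p : ℤ)) ^ 4 ∣
      ((∑ k ∈ Finset.range p, (2 * (k : ℚ) + 1) * (apT k : ℚ) / (-4) ^ k) -
        ((-1) ^ ((p - 1) / 2) * (p : ℚ) + (p : ℚ) ^ 3 * eulerNumber (p - 3))).num := by
  refine RatDvd.dvd_num hp ?_
  obtain ⟨m, hm⟩ : ∃ m, p = 2 * m + 1 := hp.odd_of_ne_two (by omega)
  have hS := sum_apT_eq m
  rw [← hm] at hS
  rw [hS, show (p - 1) / 2 = m by omega]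
  have h1 : RatDvd p 4 (∑ k ∈ range p, (-1 : ℚ) ^ k * m.choose k * (m + k).choose k *
      (sineProduct p k - (1 - (p : ℚ) ^ 2 / 4 * harmonicTwo k))) :=
    RatDvd.sum hp fun k hk => by
      refine RatDvd.mul_left hp ?_ (ratDvd_sineProduct_sub hp hp3 k (mem_range.1 hk))
      exact_mod_cast RatDvd.intCast hp ((-1) ^ k * m.choose k * (m + k).choose k)
  have h2 : RatDvd p 4 ((p : ℚ) ^ 3 * _) :=
    (RatDvd.self_pow hp).mul hp (ratDvd_sum_sub_eulerNumber hp hp3 hm)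
  have h3 : RatDvd p 0 (p : ℚ) := by exact_mod_cast RatDvd.intCast hp p
  convert (h3.mul_left hp h1).add hp h2 using 1
  have h4 : ∑ k ∈ range p, (-1 : ℚ) ^ k * m.choose k * (m + k).choose k *
      (sineProduct p k - (1 - (p : ℚ) ^ 2 / 4 * harmonicTwo k)) =
      ∑ k ∈ range p, (-1 : ℚ) ^ k * m.choose k * (m + k).choose k * sineProduct p k -
      ∑ k ∈ range p, (-1 : ℚ) ^ k * m.choose k * (m + k).choose k +
      (p : ℚ) ^ 2 / 4 *
        ∑ k ∈ range p, (-1 : ℚ) ^ k * m.choose k * (m + k).choose k * harmonicTwo k := by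
    rw [mul_sum, ← sum_sub_distrib, ← sum_add_distrib]
    exact sum_congr rfl fun k _ => by ring
  rw [h4, sum_legendre p m (by omega), sum_legendre_mul_harmonicTwo p m (by omega)]
  ring
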